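/- The map ∇'(Σᵢ Aᵢ⊗aᵢ) := Σ_{i,k} τ(Xₖ)Aᵢ ⊗ ∂^k(aᵢ) also realizes the noncommutative Poisson bracket as a Hochschild coboundary on the classical family algebra: for all 𝒜, ℬ ∈ C_τ(𝔤), one has {𝒜,ℬ} = ∇'(𝒜ℬ) − 𝒜·∇'(ℬ) − ∇'(𝒜)·ℬ. Moreover, if 𝔤 is semisimple then ∇' = ∇ on C_τ(𝔤). -/

import Mathlib

open TensorProduct MvPolynomial

noncomputable section

/-- The bilinear map `(a, b) ↦ u * D₁ a * D₂ b` on polynomials. -/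
def bil {n : ℕ} (u : MvPolynomial (Fin n) ℂ)
    (D₁ D₂ : MvPolynomial (Fin n) ℂ →ₗ[ℂ] MvPolynomial (Fin n) ℂ) :
    MvPolynomial (Fin n) ℂ →ₗ[ℂ] MvPolynomial (Fin n) ℂ →ₗ[ℂ] MvPolynomial (Fin n) ℂ :=
  (((LinearMap.mul ℂ (MvPolynomial (Fin n) ℂ)).comp
      ((LinearMap.mulLeft ℂ u).comp D₁)).compl₂ D₂)

/-- The Poisson bracket `{a,b} = Σ c^k_{ij} X_k (∂^i a)(∂^j b)` on `S(𝔤)`. -/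
def Pb {n : ℕ} (c : Fin n → Fin n → Fin n → ℂ) :
    MvPolynomial (Fin n) ℂ →ₗ[ℂ] MvPolynomial (Fin n) ℂ →ₗ[ℂ] MvPolynomial (Fin n) ℂ :=
  ∑ i, ∑ j, ∑ k, c k i j •
    bil (X k) (pderiv i).toLinearMap (pderiv j).toLinearMap

/-- The noncommutative Poisson bracket on `End V ⊗ S(𝔤)`:
`{A ⊗ a, B ⊗ b} = AB ⊗ {a,b}`. -/
def Pnc {n : ℕ} (c : Fin n → Fin n → Fin n → ℂ) (V : Type*) [AddCommGroup V] [Module ℂ V] :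
    (Module.End ℂ V ⊗[ℂ] MvPolynomial (Fin n) ℂ) →ₗ[ℂ]
      (Module.End ℂ V ⊗[ℂ] MvPolynomial (Fin n) ℂ) →ₗ[ℂ]
        (Module.End ℂ V ⊗[ℂ] MvPolynomial (Fin n) ℂ) :=
  TensorProduct.map₂ (LinearMap.mul ℂ (Module.End ℂ V)) (Pb c)

/-- `A ↦ [f, A]` on `End V`. -/
def adE {V : Type*} [AddCommGroup V] [Module ℂ V] (f : Module.End ℂ V) :
    Module.End ℂ V →ₗ[ℂ] Module.End ℂ V :=
  LinearMap.mulLeft ℂ f - LinearMap.mulRight ℂ f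

/-- The diagonal `𝔤`-action of the basis vector `X_l` on `End V ⊗ S(𝔤)`. -/
def Dact {n : ℕ} (c : Fin n → Fin n → Fin n → ℂ) {V : Type*} [AddCommGroup V] [Module ℂ V]
    (τ : Fin n → Module.End ℂ V) (l : Fin n) :
    (Module.End ℂ V ⊗[ℂ] MvPolynomial (Fin n) ℂ) →ₗ[ℂ]
      (Module.End ℂ V ⊗[ℂ] MvPolynomial (Fin n) ℂ) :=
  LinearMap.rTensor _ (adE (τ l)) + LinearMap.lTensor _ (Pb c (X l))

/-- The map `∇ : A ⊗ a ↦ Σₖ A·τ(Xₖ) ⊗ ∂^k(a)` on `End V ⊗ S(𝔤)`. -/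
def nabla {n : ℕ} {V : Type*} [AddCommGroup V] [Module ℂ V]
    (τ : Fin n → Module.End ℂ V) :
    (Module.End ℂ V ⊗[ℂ] MvPolynomial (Fin n) ℂ) →ₗ[ℂ]
      (Module.End ℂ V ⊗[ℂ] MvPolynomial (Fin n) ℂ) :=
  ∑ k, (LinearMap.mulRight ℂ ((τ k) ⊗ₜ[ℂ] (1 : MvPolynomial (Fin n) ℂ))).comp
    (LinearMap.lTensor (Module.End ℂ V) (pderiv k).toLinearMap)

/-- The map `∇' : A ⊗ a ↦ Σₖ τ(Xₖ)·A ⊗ ∂^k(a)` on `End V ⊗ S(𝔤)`. -/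
def nabla' {n : ℕ} {V : Type*} [AddCommGroup V] [Module ℂ V]
    (τ : Fin n → Module.End ℂ V) :
    (Module.End ℂ V ⊗[ℂ] MvPolynomial (Fin n) ℂ) →ₗ[ℂ]
      (Module.End ℂ V ⊗[ℂ] MvPolynomial (Fin n) ℂ) :=
  ∑ k, (LinearMap.mulLeft ℂ ((τ k) ⊗ₜ[ℂ] (1 : MvPolynomial (Fin n) ℂ))).comp
    (LinearMap.lTensor (Module.End ℂ V) (pderiv k).toLinearMap)

/-- The Killing matrix `κ_{ij} = tr(ad Xᵢ ∘ ad Xⱼ)` expressed via structure constants. -/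
def killingMat {n : ℕ} (c : Fin n → Fin n → Fin n → ℂ) : Matrix (Fin n) (Fin n) ℂ :=
  fun i j => ∑ m, ∑ k, c m i k * c k j m

section Unimodular

variable {n : ℕ} {c : Fin n → Fin n → Fin n → ℂ}

/-- The matrix of `ad Xᵢ` in the basis `X₁,…,Xₙ`. -/
def adMat (c : Fin n → Fin n → Fin n → ℂ) (i : Fin n) : Matrix (Fin n) (Fin n) ℂ :=
  Matrix.of fun m k => c m i k

lemma adMat_commutator (hskew : ∀ k i j, c k i j = - c k j i)
    (hjac : ∀ i j l m,
      (∑ k, (c k i j * c m k l + c k j l * c m k i + c k l i * c m k j)) = 0) (i j : Fin n) :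
    adMat c i * adMat c j - adMat c j * adMat c i = ∑ k, c k i j • adMat c k := by
  ext m l
  simp only [adMat, Matrix.sub_apply, Matrix.mul_apply, Matrix.sum_apply, Matrix.smul_apply,
    Matrix.of_apply, smul_eq_mul]
  rw [← sub_eq_zero, ← neg_eq_zero, ← hjac i j l m, ← Finset.sum_sub_distrib,
    ← Finset.sum_sub_distrib, ← Finset.sum_neg_distrib]
  refine Finset.sum_congr rfl fun k _ => ?_
  rw [hskew m i k, hskew m j k, hskew k i l]
  ring

lemma killingMat_eq_trace (i j : Fin n) :
    killingMat c i j = (adMat c i * adMat c j).trace := by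
  simp [killingMat, Matrix.trace, Matrix.mul_apply, adMat]

/-- A Lie algebra with nondegenerate Killing form is unimodular. -/
lemma trace_adMat_eq_zero (hskew : ∀ k i j, c k i j = - c k j i)
    (hjac : ∀ i j l m,
      (∑ k, (c k i j * c m k l + c k j l * c m k i + c k l i * c m k j)) = 0)
    (hκ : IsUnit (killingMat c).det) (j : Fin n) : (adMat c j).trace = 0 := by
  have hcomm := adMat_commutator hskew hjac
  set t : Fin n → ℂ := fun j => (adMat c j).trace
  set v : Fin n → ℂ := Matrix.vecMul t (killingMat c)⁻¹ with hv
  have hvκ : Matrix.vecMul v (killingMat c) = t := by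
    rw [hv, Matrix.vecMul_vecMul, Matrix.nonsing_inv_mul _ hκ, Matrix.vecMul_one]
  set N : Matrix (Fin n) (Fin n) ℂ := ∑ i, v i • adMat c i with hN
  have hNt (j : Fin n) : (N * adMat c j).trace = (adMat c j).trace := by
    have h := congrFun hvκ j
    simp only [Matrix.vecMul, dotProduct, killingMat_eq_trace] at h
    simpa [hN, Finset.sum_mul, Matrix.trace_sum] using h
  have hNcomm (x : Fin n) : N * adMat c x - adMat c x * N = ∑ k, N k x • adMat c k := by
    calc N * adMat c x - adMat c x * N
        = ∑ i, v i • (adMat c i * adMat c x - adMat c x * adMat c i) := by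
          simp [hN, Finset.sum_mul, Finset.mul_sum, smul_sub]
      _ = ∑ k, N k x • adMat c k := by
          simp only [hcomm, Finset.smul_sum, hN, Matrix.sum_apply, Finset.sum_smul]
          rw [Finset.sum_comm]
          simp [adMat, smul_smul]
  have hNκ : N.transpose * killingMat c = 0 := by
    ext x y
    calc (N.transpose * killingMat c) x y
        = ((∑ k, N k x • adMat c k) * adMat c y).trace := by
          simp [Matrix.mul_apply, killingMat_eq_trace, Finset.sum_mul, Matrix.trace_sum]
      _ = (N * (adMat c x * adMat c y - adMat c y * adMat c x)).trace := by
          rw [← hNcomm, sub_mul, mul_sub, Matrix.trace_sub, Matrix.trace_sub,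
            Matrix.trace_mul_cycle (adMat c x), Matrix.mul_assoc N,
            Matrix.trace_mul_comm (adMat c y * adMat c x)]
      _ = (adMat c x * adMat c y - adMat c y * adMat c x).trace := by
          simp only [hcomm, Finset.mul_sum, Matrix.trace_sum, mul_smul_comm, Matrix.trace_smul, hNt]
      _ = 0 := by rw [Matrix.trace_sub, Matrix.trace_mul_comm, sub_self]
  have hN0 : N.transpose = 0 := by
    rw [← Matrix.mul_nonsing_inv_cancel_right _ N.transpose hκ, hNκ, zero_mul]
  rw [← hNt, Matrix.transpose_eq_zero.mp hN0, zero_mul, Matrix.trace_zero]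

end Unimodular

section FamilyAlgebra

variable {n : ℕ} {c : Fin n → Fin n → Fin n → ℂ} {V : Type*} [AddCommGroup V] [Module ℂ V]

/-- The partial derivative `A ⊗ a ↦ A ⊗ ∂^k(a)` on `End V ⊗ S(𝔤)`. -/
def endPderiv (V : Type*) [AddCommGroup V] [Module ℂ V] (k : Fin n) :
    (Module.End ℂ V ⊗[ℂ] MvPolynomial (Fin n) ℂ) →ₗ[ℂ]
      (Module.End ℂ V ⊗[ℂ] MvPolynomial (Fin n) ℂ) :=
  LinearMap.lTensor (Module.End ℂ V) (pderiv k).toLinearMap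

/-- The central element `1 ⊗ X_k` of `End V ⊗ S(𝔤)`. -/
def endX (V : Type*) [AddCommGroup V] [Module ℂ V] (k : Fin n) :
    Module.End ℂ V ⊗[ℂ] MvPolynomial (Fin n) ℂ :=
  1 ⊗ₜ X k

@[simp]
lemma endPderiv_tmul (k : Fin n) (A : Module.End ℂ V) (a : MvPolynomial (Fin n) ℂ) :
    endPderiv V k (A ⊗ₜ a) = A ⊗ₜ pderiv k a := rfl

lemma endPderiv_mul (k : Fin n) (x y : Module.End ℂ V ⊗[ℂ] MvPolynomial (Fin n) ℂ) :
    endPderiv V k (x * y) = endPderiv V k x * y + x * endPderiv V k y := by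
  induction x with
  | zero => simp
  | add x₁ x₂ h₁ h₂ => simp only [add_mul, map_add, h₁, h₂]; abel
  | tmul A a =>
    induction y with
    | zero => simp
    | add y₁ y₂ h₁ h₂ => simp only [mul_add, map_add, h₁, h₂]; abel
    | tmul B b =>
      simp only [Algebra.TensorProduct.tmul_mul_tmul, endPderiv_tmul, Derivation.leibniz,
        smul_eq_mul, ← tmul_add]
      congr 1
      ring

lemma pderiv_pderiv_comm (j k : Fin n) (a : MvPolynomial (Fin n) ℂ) :
    pderiv j (pderiv k a) = pderiv k (pderiv j a) := by
  have h : ⁅pderiv (R := ℂ) j, pderiv (R := ℂ) k⁆ = 0 := by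
    refine derivation_ext fun i => ?_
    simp [Derivation.commutator_apply, pderiv_X, Pi.single_apply, apply_ite]
  rw [← sub_eq_zero, ← Derivation.commutator_apply, h, Derivation.zero_apply]

lemma endPderiv_comm (j k : Fin n) (x : Module.End ℂ V ⊗[ℂ] MvPolynomial (Fin n) ℂ) :
    endPderiv V j (endPderiv V k x) = endPderiv V k (endPderiv V j x) := by
  induction x with
  | zero => simp
  | add x y hx hy => simp only [map_add, hx, hy]
  | tmul A a => simp only [endPderiv_tmul, pderiv_pderiv_comm j k a]

lemma endPderiv_tmul_one (k : Fin n) (A : Module.End ℂ V) :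
    endPderiv V k (A ⊗ₜ 1) = 0 := by
  simp

lemma endPderiv_endX (j k : Fin n) :
    endPderiv V j (endX V k) = if k = j then 1 else 0 := by
  rw [endX, endPderiv_tmul, pderiv_X, Pi.single_apply]
  split_ifs <;> simp [Algebra.TensorProduct.one_def]

lemma Pb_apply (a b : MvPolynomial (Fin n) ℂ) :
    Pb c a b = ∑ i, ∑ j, ∑ k, c k i j • (X k * pderiv i a * pderiv j b) := by
  simp [Pb, bil]

lemma Pnc_apply (x y : Module.End ℂ V ⊗[ℂ] MvPolynomial (Fin n) ℂ) :
    Pnc c V x y =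
      ∑ i, ∑ j, ∑ k, c k i j • (endX V k * endPderiv V i x * endPderiv V j y) := by
  induction x with
  | zero => simp
  | add x₁ x₂ h₁ h₂ =>
    simp only [map_add, LinearMap.add_apply, h₁, h₂, mul_add, add_mul, smul_add,
      Finset.sum_add_distrib]
  | tmul A a =>
    induction y with
    | zero => simp
    | add y₁ y₂ h₁ h₂ => simp only [map_add, h₁, h₂, mul_add, smul_add, Finset.sum_add_distrib]
    | tmul B b =>
      simp only [Pnc, map₂_apply_tmul, TensorProduct.map_tmul, LinearMap.mul_apply', Pb_apply, endX, endPderiv_tmul,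
        Algebra.TensorProduct.tmul_mul_tmul, one_mul, tmul_sum, tmul_smul]

lemma Dact_apply (τ : Fin n → Module.End ℂ V) (l : Fin n)
    (x : Module.End ℂ V ⊗[ℂ] MvPolynomial (Fin n) ℂ) :
    Dact c τ l x = τ l ⊗ₜ 1 * x - x * τ l ⊗ₜ 1 +
      ∑ j, ∑ k, c k l j • (endX V k * endPderiv V j x) := by
  induction x with
  | zero => simp
  | add x y hx hy =>
    simp only [map_add, hx, hy, mul_add, add_mul, smul_add, Finset.sum_add_distrib]
    abel
  | tmul A a =>
    have hX : Pb c (X l) a = ∑ j, ∑ k, c k l j • (X k * pderiv j a) := by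
      rw [Pb_apply, Finset.sum_eq_single l]
      · simp
      · intro i _ hi
        simp [pderiv_X_of_ne hi.symm]
      · simp
    simp only [Dact, adE, LinearMap.add_apply, LinearMap.rTensor_tmul, LinearMap.lTensor_tmul,
      LinearMap.sub_apply, LinearMap.mulLeft_apply, LinearMap.mulRight_apply, hX, endX,
      endPderiv_tmul, Algebra.TensorProduct.tmul_mul_tmul, one_mul, mul_one, tmul_sum, tmul_smul,
      sub_tmul]

lemma commutator_of_Dact_eq_zero (hskew : ∀ k i j, c k i j = - c k j i)
    {τ : Fin n → Module.End ℂ V} {l : Fin n}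
    {x : Module.End ℂ V ⊗[ℂ] MvPolynomial (Fin n) ℂ} (hx : Dact c τ l x = 0) :
    τ l ⊗ₜ 1 * x - x * τ l ⊗ₜ 1 = ∑ j, ∑ k, c k j l • (endX V k * endPderiv V j x) := by
  rw [Dact_apply] at hx
  refine add_right_cancel (hx.trans (Eq.symm ?_))
  simp only [← Finset.sum_add_distrib]
  refine Finset.sum_eq_zero fun j _ => Finset.sum_eq_zero fun k _ => ?_
  rw [← add_smul, hskew k j l, neg_add_cancel, zero_smul]

lemma nabla_apply (τ : Fin n → Module.End ℂ V)
    (x : Module.End ℂ V ⊗[ℂ] MvPolynomial (Fin n) ℂ) :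
    nabla τ x = ∑ k, endPderiv V k x * τ k ⊗ₜ 1 := by
  simp [nabla, endPderiv]

lemma nabla'_apply (τ : Fin n → Module.End ℂ V)
    (x : Module.End ℂ V ⊗[ℂ] MvPolynomial (Fin n) ℂ) :
    nabla' τ x = ∑ k, τ k ⊗ₜ 1 * endPderiv V k x := by
  simp [nabla', endPderiv]

lemma nabla'_mul_sub (τ : Fin n → Module.End ℂ V)
    (x y : Module.End ℂ V ⊗[ℂ] MvPolynomial (Fin n) ℂ) :
    nabla' τ (x * y) - x * nabla' τ y - nabla' τ x * y =
      ∑ k, (τ k ⊗ₜ 1 * x - x * τ k ⊗ₜ 1) * endPderiv V k y := by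
  simp only [nabla'_apply, Finset.sum_mul, Finset.mul_sum, ← Finset.sum_sub_distrib]
  refine Finset.sum_congr rfl fun k _ => ?_
  rw [endPderiv_mul]
  simp only [sub_mul, mul_add, mul_assoc]
  abel

lemma nabla'_sub_nabla (τ : Fin n → Module.End ℂ V)
    (x : Module.End ℂ V ⊗[ℂ] MvPolynomial (Fin n) ℂ) :
    nabla' τ x - nabla τ x = ∑ k, endPderiv V k (τ k ⊗ₜ 1 * x - x * τ k ⊗ₜ 1) := by
  simp only [nabla'_apply, nabla_apply, map_sub, endPderiv_mul, endPderiv_tmul_one, zero_mul,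
    mul_zero, zero_add, add_zero, Finset.sum_sub_distrib]

lemma sum_smul_endX_mul_endPderiv_endPderiv (hskew : ∀ k i j, c k i j = - c k j i)
    (x : Module.End ℂ V ⊗[ℂ] MvPolynomial (Fin n) ℂ) :
    ∑ l, ∑ j, ∑ k, c k j l • (endX V k * endPderiv V l (endPderiv V j x)) = 0 := by
  refine (smul_eq_zero_iff_right (two_ne_zero' ℂ)).mp ?_
  rw [two_smul]
  nth_rewrite 2 [Finset.sum_comm]
  simp only [← Finset.sum_add_distrib]
  refine Finset.sum_eq_zero fun l _ => Finset.sum_eq_zero fun j _ =>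
    Finset.sum_eq_zero fun k _ => ?_
  rw [endPderiv_comm j l, ← add_smul, hskew k l j, add_neg_cancel, zero_smul]

lemma nabla'_sub_nabla_of_invariant (hskew : ∀ k i j, c k i j = - c k j i)
    {τ : Fin n → Module.End ℂ V} {x : Module.End ℂ V ⊗[ℂ] MvPolynomial (Fin n) ℂ}
    (hx : ∀ l, Dact c τ l x = 0) :
    nabla' τ x - nabla τ x = ∑ j, (adMat c j).trace • endPderiv V j x := by
  simp only [nabla'_sub_nabla, commutator_of_Dact_eq_zero hskew (hx _), map_sum, map_smul,
    endPderiv_mul, smul_add, Finset.sum_add_distrib,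
    sum_smul_endX_mul_endPderiv_endPderiv hskew, add_zero]
  rw [Finset.sum_comm]
  simp [endPderiv_endX, ite_mul, Matrix.trace, adMat, Finset.sum_smul]

end FamilyAlgebra

/-- `∇'` also realizes the noncommutative Poisson bracket as a Hochschild
coboundary on `C_τ(𝔤)`: `{𝒜,ℬ} = ∇'(𝒜ℬ) − 𝒜∇'(ℬ) − ∇'(𝒜)ℬ`; moreover if `𝔤` is
semisimple (Killing form nondegenerate) then `∇' = ∇` on `C_τ(𝔤)`. -/
theorem stmt19 {n : ℕ} (c : Fin n → Fin n → Fin n → ℂ)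
    {V : Type*} [AddCommGroup V] [Module ℂ V] (τ : Fin n → Module.End ℂ V)
    (hskew : ∀ k i j, c k i j = - c k j i)
    (hjac : ∀ i j l m, (∑ k, (c k i j * c m k l + c k j l * c m k i + c k l i * c m k j)) = 0)
    (hτ : ∀ i j, τ i * τ j - τ j * τ i = ∑ k, c k i j • τ k) :
    (∀ 𝒜 ℬ : Module.End ℂ V ⊗[ℂ] MvPolynomial (Fin n) ℂ,
      (∀ l, Dact c τ l 𝒜 = 0) → (∀ l, Dact c τ l ℬ = 0) →
        Pnc c V 𝒜 ℬ = nabla' τ (𝒜 * ℬ) - 𝒜 * nabla' τ ℬ - nabla' τ 𝒜 * ℬ) ∧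
    (IsUnit (killingMat c).det →
      ∀ 𝒜 : Module.End ℂ V ⊗[ℂ] MvPolynomial (Fin n) ℂ,
        (∀ l, Dact c τ l 𝒜 = 0) → nabla' τ 𝒜 = nabla τ 𝒜) := by
  refine ⟨fun 𝒜 ℬ h𝒜 _ => ?_, fun hκ 𝒜 h𝒜 => ?_⟩
  · rw [nabla'_mul_sub, Pnc_apply, Finset.sum_comm]
    simp only [commutator_of_Dact_eq_zero hskew (h𝒜 _), Finset.sum_mul, smul_mul_assoc]
  · rw [← sub_eq_zero, nabla'_sub_nabla_of_invariant hskew h𝒜]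
    simp [trace_adMat_eq_zero hskew hjac hκ]

end
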